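/- Let r ≥ 1 be an integer and n sufficiently large. If G is a non-bipartite B_{r+1}-free simple graph on n vertices with the maximum number of edges among such graphs, then G contains a triangle C such that the induced subgraph G \ V(C) on the remaining n − 3 vertices is isomorphic to the Turán graph T_{n−3,2}, and the number of edges between V(C) and V(G) \ V(C) equals n + 2r − 5. -/

import Mathlib

open SimpleGraph Set

/-- `G` contains no book `B_{r+1}`, i.e. no two adjacent vertices of `G` have at least
`r + 1` common neighbours. -/
def BookFree {V : Type*} (r : ℕ) (G : SimpleGraph V) : Prop :=
  ∀ u v : V, G.Adj u v → ({w : V | G.Adj u w ∧ G.Adj v w}).ncard ≤ r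

/-- `e(S, T)`: the number of edges of `G` with one endpoint in `S` and the other in `T`. -/
noncomputable def cutCount {V : Type*} (G : SimpleGraph V) (S T : Set V) : ℕ :=
  {e ∈ G.edgeSet | ∃ u ∈ S, ∃ v ∈ T, e = s(u, v)}.ncard

section Basic

open Classical in
/-- number of ordered pairs in `S × T` satisfying `P` -/
noncomputable def ee {V : Type*} (P : V → V → Prop) (S T : Finset V) : ℕ :=
  ∑ s ∈ S, ∑ t ∈ T, if P s t then 1 else 0

open Classical in
/-- the `P`-neighbours of `v` inside `T` -/
noncomputable def nb {V : Type*} (P : V → V → Prop) (v : V) (T : Finset V) : Finset V :=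
  T.filter (P v)

theorem mem_nb {V : Type*} {P : V → V → Prop} {v w : V} {T : Finset V} :
    w ∈ nb P v T ↔ w ∈ T ∧ P v w := by
  simp [nb]

theorem ee_eq_sum_nb {V : Type*} (P : V → V → Prop) (S T : Finset V) :
    ee P S T = ∑ s ∈ S, (nb P s T).card := by
  classical
  simp [ee, nb]

theorem ee_singleton {V : Type*} (P : V → V → Prop) (v : V) (T : Finset V) :
    ee P {v} T = (nb P v T).card := by
  simp [ee_eq_sum_nb]

theorem ee_comm {V : Type*} {P : V → V → Prop} (hP : ∀ a b, P a b → P b a) (S T : Finset V) :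
    ee P S T = ee P T S := by
  unfold ee
  rw [Finset.sum_comm]
  refine Finset.sum_congr rfl fun a _ => Finset.sum_congr rfl fun b _ => ?_
  by_cases h : P a b
  · simp [h, hP _ _ h]
  · have h' : ¬ P b a := fun h' => h (hP _ _ h')
    simp [h, h']

theorem ee_union_right {V : Type*} [DecidableEq V] (P : V → V → Prop) (S T U : Finset V)
    (h : Disjoint T U) : ee P S (T ∪ U) = ee P S T + ee P S U := by
  unfold ee
  rw [← Finset.sum_add_distrib]
  exact Finset.sum_congr rfl fun a _ => Finset.sum_union h

theorem ee_union_left {V : Type*} [DecidableEq V] (P : V → V → Prop) (S T U : Finset V)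
    (h : Disjoint S T) : ee P (S ∪ T) U = ee P S U + ee P T U := by
  unfold ee
  exact Finset.sum_union h

theorem ee_le_of_nb {V : Type*} (P : V → V → Prop) (S T : Finset V) (k : ℕ)
    (h : ∀ s ∈ S, (nb P s T).card ≤ k) : ee P S T ≤ S.card * k := by
  rw [ee_eq_sum_nb, ← smul_eq_mul]
  exact Finset.sum_le_card_nsmul _ _ _ h

theorem nb_card_le {V : Type*} (P : V → V → Prop) (v : V) (T : Finset V) :
    (nb P v T).card ≤ T.card := by
  classical
  exact Finset.card_le_card fun w hw => (mem_nb.1 hw).1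

theorem ee_le {V : Type*} (P : V → V → Prop) (S T : Finset V) :
    ee P S T ≤ S.card * T.card :=
  ee_le_of_nb _ _ _ _ fun _ _ => nb_card_le _ _ _

theorem ee_add_not {V : Type*} (P : V → V → Prop) (S T : Finset V) :
    ee P S T + ee (fun a b => ¬ P a b) S T = S.card * T.card := by
  classical
  unfold ee
  rw [← Finset.sum_add_distrib]
  have : ∀ s ∈ S, ((∑ t ∈ T, if P s t then 1 else 0) + ∑ t ∈ T, if ¬ P s t then 1 else 0)
      = T.card := by
    intro s _
    rw [← Finset.sum_add_distrib, Finset.card_eq_sum_ones]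
    refine Finset.sum_congr rfl fun t _ => ?_
    by_cases h : P s t <;> simp [h]
  have h2 := Finset.sum_congr rfl this
  rw [Finset.sum_const, smul_eq_mul] at h2
  convert h2 using 5

theorem nb_mono {V : Type*} (P : V → V → Prop) (v : V) {T T' : Finset V} (h : T ⊆ T') :
    nb P v T ⊆ nb P v T' := by
  intro w; simp only [mem_nb]; exact fun hw => ⟨h hw.1, hw.2⟩

theorem ee_mono {V : Type*} (P : V → V → Prop) {S T S' T' : Finset V} (hS : S ⊆ S')
    (hT : T ⊆ T') : ee P S T ≤ ee P S' T' := by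
  rw [ee_eq_sum_nb, ee_eq_sum_nb]
  calc ∑ s ∈ S, (nb P s T).card ≤ ∑ s ∈ S, (nb P s T').card :=
        Finset.sum_le_sum fun s _ => Finset.card_le_card (nb_mono _ _ hT)
    _ ≤ _ := Finset.sum_le_sum_of_subset hS

theorem ee_eq_zero {V : Type*} (P : V → V → Prop) {S T : Finset V}
    (h : ∀ s ∈ S, ∀ t ∈ T, ¬ P s t) : ee P S T = 0 := by
  unfold ee
  refine Finset.sum_eq_zero fun s hs => Finset.sum_eq_zero fun t ht => ?_
  simp [h s hs t ht]

theorem ee_full {V : Type*} (P : V → V → Prop) {S T : Finset V}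
    (h : ∀ s ∈ S, ∀ t ∈ T, P s t) : ee P S T = S.card * T.card := by
  have := ee_add_not P S T
  rw [ee_eq_zero (fun a b => ¬ P a b) (by simpa using h)] at this
  simpa using this

theorem ee_pos {V : Type*} (P : V → V → Prop) {S T : Finset V}
    (h : 0 < ee P S T) : ∃ s ∈ S, ∃ t ∈ T, P s t := by
  by_contra! hc
  have := ee_eq_zero P hc
  omega

theorem ee_univ {V : Type*} [Fintype V] (G : SimpleGraph V) :
    ee G.Adj Finset.univ Finset.univ = 2 * G.edgeSet.ncard := by
  classical
  have h := G.sum_degrees_eq_twice_card_edges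
  rw [Set.ncard_eq_toFinset_card', ee_eq_sum_nb]
  have h2 : ∀ v, (nb G.Adj v Finset.univ).card = G.degree v := by
    intro v
    rw [← G.card_neighborFinset_eq_degree]
    congr 1
    ext w; simp [mem_nb]
  simp only [h2]
  rw [h]
  rfl

theorem nb_add {V : Type*} [Fintype V] (P : V → V → Prop) (v : V)
    (A B R : Finset V) (hAB : Disjoint A B) (hAR : Disjoint A R) (hBR : Disjoint B R)
    (hU : ∀ v, v ∈ A ∨ v ∈ B ∨ v ∈ R) :
    (nb P v Finset.univ).card = (nb P v A).card + (nb P v B).card + (nb P v R).card := by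
  classical
  have hu : (Finset.univ : Finset V) = (A ∪ B) ∪ R := by
    ext v; simp [hU v]
  have h1 : Disjoint (A ∪ B) R := Finset.disjoint_union_left.2 ⟨hAR, hBR⟩
  rw [← ee_singleton, ← ee_singleton, ← ee_singleton, ← ee_singleton, hu,
    ee_union_right _ _ _ _ h1, ee_union_right _ _ _ _ hAB]

theorem card_split {V : Type*} [Fintype V]
    (A B R : Finset V) (hAB : Disjoint A B) (hAR : Disjoint A R) (hBR : Disjoint B R)
    (hU : ∀ v, v ∈ A ∨ v ∈ B ∨ v ∈ R) :
    Fintype.card V = A.card + B.card + R.card := by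
  classical
  have hu : (Finset.univ : Finset V) = (A ∪ B) ∪ R := by
    ext v; simp [hU v]
  have h1 : Disjoint (A ∪ B) R := Finset.disjoint_union_left.2 ⟨hAR, hBR⟩
  rw [← Finset.card_univ, hu, Finset.card_union_of_disjoint h1, Finset.card_union_of_disjoint hAB]

theorem ee_split {V : Type*} [Fintype V] (G : SimpleGraph V)
    (A B R : Finset V) (hAB : Disjoint A B) (hAR : Disjoint A R) (hBR : Disjoint B R)
    (hU : ∀ v, v ∈ A ∨ v ∈ B ∨ v ∈ R) :
    2 * G.edgeSet.ncard = ee G.Adj A A + ee G.Adj B B + ee G.Adj R R +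
      2 * ee G.Adj A B + 2 * ee G.Adj R A + 2 * ee G.Adj R B := by
  classical
  have hs : ∀ a b, G.Adj a b → G.Adj b a := fun a b h => h.symm
  have hu : (Finset.univ : Finset V) = (A ∪ B) ∪ R := by
    ext v; simp [hU v]
  have h1 : Disjoint (A ∪ B) R := Finset.disjoint_union_left.2 ⟨hAR, hBR⟩
  rw [← ee_univ, hu]
  simp only [ee_union_right _ _ _ _ h1, ee_union_left _ _ _ _ h1, ee_union_right _ _ _ _ hAB,
    ee_union_left _ _ _ _ hAB]
  rw [ee_comm hs B A, ee_comm hs A R, ee_comm hs B R]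
  ring

/-- Book-freeness, in finset form, with respect to arbitrary vertex sets. -/
theorem BookFree.card_le {V : Type*} [Fintype V] {r : ℕ} {G : SimpleGraph V}
    (h : BookFree r G) {u v : V} (huv : G.Adj u v) (T : Finset V)
    (hT : ∀ w ∈ T, G.Adj u w ∧ G.Adj v w) : T.card ≤ r := by
  refine le_trans ?_ (h u v huv)
  rw [← Set.ncard_coe_finset]
  exact Set.ncard_le_ncard (fun w hw => hT w hw) (Set.toFinite _)

/-- two adjacent vertices have few neighbours in total in any set -/
theorem BookFree.nb_le {V : Type*} [Fintype V] {r : ℕ} {G : SimpleGraph V}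
    (h : BookFree r G) {u v : V} (huv : G.Adj u v) (T : Finset V) :
    (nb G.Adj u T).card + (nb G.Adj v T).card ≤ T.card + r := by
  classical
  rw [← Finset.card_union_add_card_inter]
  refine add_le_add (Finset.card_le_card ?_) (h.card_le huv _ ?_)
  · intro w; simp only [Finset.mem_union, mem_nb]; tauto
  · intro w; simp only [Finset.mem_inter, mem_nb]; tauto

end Basic

section Construction

/-- the relation used for the extremal example -/
def exRel (r p n : ℕ) (i j : ℕ) : Prop :=
  (i < p ∧ p ≤ j ∧ j + 1 < n) ∨ (j + 1 = n ∧ (i < r ∨ (p ≤ i ∧ i < p + r)))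

theorem exRel_irrefl {r p n i : ℕ} (h1 : p + r + 1 ≤ n) (h2 : r ≤ p) : ¬ exRel r p n i i := by
  unfold exRel; omega

/-- the extremal example -/
def exGraph (r p n : ℕ) (h1 : p + r + 1 ≤ n) (h2 : r ≤ p) : SimpleGraph (Fin n) where
  Adj i j := exRel r p n i j ∨ exRel r p n j i
  symm := ⟨fun _ _ h => h.symm⟩
  loopless := ⟨fun i h => by
    rcases h with h | h <;> exact exRel_irrefl h1 h2 h⟩

theorem exGraph_book (r p n : ℕ) (hr : 1 ≤ r) (h1 : p + r + 1 ≤ n) (h2 : r ≤ p) :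
    BookFree r (exGraph r p n h1 h2) := by
  have key : ∀ (a k : ℕ) (S : Set (Fin n)), k ≤ r → (∀ w ∈ S, a ≤ (w : ℕ) ∧ (w : ℕ) < a + k) →
      S.ncard ≤ r := by
    intro a k S hk hS
    have hinj : (Fin.val '' S).ncard = S.ncard := Set.ncard_image_of_injective _ Fin.val_injective
    rw [← hinj]
    have hsub : Fin.val '' S ⊆ ((Finset.Ico a (a + k) : Finset ℕ) : Set ℕ) := by
      rintro _ ⟨w, hw, rfl⟩
      simpa using hS w hw
    have := Set.ncard_le_ncard hsub (Finset.finite_toSet _)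
    rw [Set.ncard_coe_finset] at this
    simp at this
    omega
  intro u v huv
  have hu := u.2
  have hv := v.2
  simp only [exGraph, exRel] at huv
  by_cases c1 : (u : ℕ) + 1 < n ∧ (v : ℕ) + 1 < n
  · refine key (n - 1) 1 _ hr ?_
    intro w hw
    have := w.2
    simp only [exGraph, exRel, Set.mem_ofPred_eq] at hw
    omega
  · by_cases c2 : (u : ℕ) < p ∨ (v : ℕ) < p
    · refine key p r _ le_rfl ?_
      intro w hw
      have := w.2
      simp only [exGraph, exRel, Set.mem_ofPred_eq] at hw
      omega
    · refine key 0 r _ le_rfl ?_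
      intro w hw
      have := w.2
      simp only [exGraph, exRel, Set.mem_ofPred_eq] at hw
      omega

theorem not_colorable_of_triangle {V : Type*} (G : SimpleGraph V) (a b c : V)
    (h1 : G.Adj a b) (h2 : G.Adj b c) (h3 : G.Adj a c) : ¬ G.Colorable 2 := by
  rintro ⟨C⟩
  have e1 := C.valid h1
  have e2 := C.valid h2
  have e3 := C.valid h3
  have := (C a).2
  have := (C b).2
  have := (C c).2
  rw [Ne, Fin.ext_iff] at e1 e2 e3
  omega

theorem exGraph_edges (r p n : ℕ) (h1 : p + r + 1 ≤ n) (h2 : r ≤ p) :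
    p * (n - 1 - p) + 2 * r ≤ (exGraph r p n h1 h2).edgeSet.ncard := by
  classical
  set G := exGraph r p n h1 h2 with hG
  let A : Finset (Fin n) := Finset.univ.filter fun i => (i : ℕ) < p
  let B : Finset (Fin n) := Finset.univ.filter fun i => p ≤ (i : ℕ) ∧ (i : ℕ) + 1 < n
  let R : Finset (Fin n) := Finset.univ.filter fun i => (i : ℕ) + 1 = n
  let X : Finset (Fin n) := Finset.univ.filter fun i => (i : ℕ) < r
  let Y : Finset (Fin n) := Finset.univ.filter fun i => p ≤ (i : ℕ) ∧ (i : ℕ) < p + r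
  have cnt : ∀ (a b : ℕ) (S : Finset (Fin n)), b ≤ n →
      (∀ w, w ∈ S ↔ a ≤ (w : ℕ) ∧ (w : ℕ) < b) → S.card = b - a := by
    intro a b S hb hS
    rw [← Finset.card_image_of_injective S Fin.val_injective]
    have : S.image Fin.val = Finset.Ico a b := by
      ext i
      simp only [Finset.mem_image, Finset.mem_Ico, hS]
      constructor
      · rintro ⟨w, hw, rfl⟩; exact hw
      · intro h; exact ⟨⟨i, by omega⟩, h, rfl⟩
    rw [this]; simp
  have cA : A.card = p := by
    have := cnt 0 p A (by omega) (by intro w; simp [A]); omega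
  have cB : B.card = n - 1 - p := by
    have := cnt p (n-1) B (by omega) (by
      intro w; have := w.2; simp [B]; omega); omega
  have cR : R.card = 1 := by
    have := cnt (n-1) n R (by omega) (by intro w; have := w.2; simp [R]; omega); omega
  have cX : X.card = r := by
    have := cnt 0 r X (by omega) (by intro w; simp [X]); omega
  have cY : Y.card = r := by
    have := cnt p (p+r) Y (by omega) (by intro w; simp [Y]); omega
  have hsp := ee_split G A B R
    (by rw [Finset.disjoint_left]; intro i; simp [A, B]; omega)
    (by rw [Finset.disjoint_left]; intro i; simp [A, R]; omega)
    (by rw [Finset.disjoint_left]; intro i; simp [R, B]; omega)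
    (by intro i; have := i.2; simp [A, B, R]; omega)
  have e1 : ee G.Adj A B = A.card * B.card := by
    apply ee_full
    intro i hi j hj
    simp only [A, B, Finset.mem_filter, Finset.mem_univ, true_and] at hi hj
    simp only [hG, exGraph, exRel]; omega
  have e2 : ee G.Adj R X = R.card * X.card := by
    apply ee_full
    intro i hi j hj
    simp only [R, X, Finset.mem_filter, Finset.mem_univ, true_and] at hi hj
    simp only [hG, exGraph, exRel]; omega
  have e3 : ee G.Adj R Y = R.card * Y.card := by
    apply ee_full
    intro i hi j hj
    simp only [R, Y, Finset.mem_filter, Finset.mem_univ, true_and] at hi hj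
    simp only [hG, exGraph, exRel]; omega
  have e4 : ee G.Adj R X ≤ ee G.Adj R A := ee_mono _ subset_rfl (by
    intro i; simp [X, A]; omega)
  have e5 : ee G.Adj R Y ≤ ee G.Adj R B := ee_mono _ subset_rfl (by
    intro i; simp [Y, B]; omega)
  rw [cA, cB] at e1
  rw [cR, cX] at e2
  rw [cR, cY] at e3
  omega

theorem lower_bound (r n : ℕ) (hr : 1 ≤ r) (hn : 2 * r + 3 ≤ n) :
    ∃ H : SimpleGraph (Fin n), ¬ H.Colorable 2 ∧ BookFree r H ∧
      ((n - 1) / 2) * (n / 2) + 2 * r ≤ H.edgeSet.ncard := by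
  have h1 : (n - 1) / 2 + r + 1 ≤ n := by omega
  have h2 : r ≤ (n - 1) / 2 := by omega
  refine ⟨exGraph r ((n-1)/2) n h1 h2, ?_, exGraph_book _ _ _ hr _ _, ?_⟩
  · apply not_colorable_of_triangle _ ⟨0, by omega⟩ ⟨(n-1)/2, by omega⟩ ⟨n-1, by omega⟩
    all_goals simp only [exGraph, exRel]; omega
  · have := exGraph_edges r ((n-1)/2) n h1 h2
    have h3 : n - 1 - (n-1)/2 = n / 2 := by omega
    rwa [h3] at this

end Construction

section Stability

theorem exists_heavy_edge {V : Type*} [Fintype V] (G : SimpleGraph V) (n : ℕ)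
    (hn : n = Fintype.card V) (hn3 : 3 ≤ n) (he : n * n ≤ 4 * G.edgeSet.ncard + 2 * n) :
    ∃ u v, G.Adj u v ∧
      n ≤ (nb G.Adj u Finset.univ).card + (nb G.Adj v Finset.univ).card + 2 := by
  classical
  by_contra! hc
  have hs : ∀ a b, G.Adj a b → G.Adj b a := fun a b h => h.symm
  set d : V → ℕ := fun v => (nb G.Adj v Finset.univ).card with hd
  have hsum : ∑ v, d v = 2 * G.edgeSet.ncard := by
    rw [← ee_univ, ee_eq_sum_nb]
  have h1 : (∑ v, d v) ^ 2 ≤ n * ∑ v, d v ^ 2 := by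
    have := sq_sum_le_card_mul_sum_sq (s := (Finset.univ : Finset V)) (f := d)
    simpa [hn] using this
  have hind : ∀ u, (∑ w, if G.Adj u w then 1 else 0) = d u := by
    intro u; simp [hd, nb]
  have h2 : ∑ u, ∑ w, (if G.Adj u w then (d u + d w) else 0) = 2 * ∑ v, d v ^ 2 := by
    have e1 : ∑ u, ∑ w, (if G.Adj u w then d u else 0) = ∑ v, d v ^ 2 := by
      refine Finset.sum_congr rfl fun u _ => ?_
      rw [sq]
      conv_rhs => rw [← hind u, Finset.sum_mul]
      refine Finset.sum_congr rfl fun w _ => ?_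
      split_ifs
      · rw [hind]; simp
      · simp
    have e2 : ∑ u, ∑ w, (if G.Adj u w then d w else 0) = ∑ v, d v ^ 2 := by
      rw [← e1, Finset.sum_comm]
      refine Finset.sum_congr rfl fun u _ => Finset.sum_congr rfl fun w _ => ?_
      simp [G.adj_comm]
    rw [two_mul]
    nth_rewrite 1 [← e1]
    rw [← e2, ← Finset.sum_add_distrib]
    refine Finset.sum_congr rfl fun u _ => ?_
    rw [← Finset.sum_add_distrib]
    refine Finset.sum_congr rfl fun w _ => ?_
    split_ifs <;> simp
  have h3 : ∑ u, ∑ w, (if G.Adj u w then (d u + d w) else 0) ≤ (n - 3) * ∑ v, d v := by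
    rw [Finset.mul_sum]
    refine Finset.sum_le_sum fun u _ => ?_
    rw [← hind u, Finset.mul_sum]
    refine Finset.sum_le_sum fun w _ => ?_
    split_ifs with h
    · have := hc u w h
      rw [hind]
      simp only [hd]; omega
    · simp
  obtain ⟨m, rfl⟩ : ∃ m, n = m + 3 := ⟨n - 3, by omega⟩
  rw [h2] at h3
  rw [hsum] at h1 h3
  simp only [Nat.add_sub_cancel] at h3
  set e := G.edgeSet.ncard
  have h4 : (2 * e) ^ 2 ≤ (m + 3) * (m * e) := by nlinarith
  have hepos : 0 < e := by nlinarith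
  have h5 : 4 * e ≤ (m + 3) * m := by
    by_contra! h
    have := Nat.mul_lt_mul_of_pos_right h hepos
    nlinarith
  nlinarith

theorem rough_structure {V : Type*} [Fintype V] (G : SimpleGraph V) (n r : ℕ)
    (hn : n = Fintype.card V) (hn3 : 3 ≤ n) (he : n * n ≤ 4 * G.edgeSet.ncard + 2 * n)
    (hB : BookFree r G) :
    ∃ A B R : Finset V, Disjoint A B ∧ Disjoint A R ∧ Disjoint B R ∧
      (∀ v, v ∈ A ∨ v ∈ B ∨ v ∈ R) ∧ R.card ≤ r + 2 ∧
      n * n ≤ 4 * ee G.Adj A B + (8 * r + 12) * n := by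
  classical
  obtain ⟨u, v, huv, hd⟩ := exists_heavy_edge G n hn hn3 he
  set A := nb G.Adj u Finset.univ with hA
  set B := nb G.Adj v Finset.univ \ A with hBd
  set R := Finset.univ \ (A ∪ B) with hR
  have d1 : Disjoint A B := Finset.disjoint_sdiff
  have d2 : Disjoint A R := by
    rw [Finset.disjoint_left]; intro x; simp [hR]; tauto
  have d3 : Disjoint B R := by
    rw [Finset.disjoint_left]; intro x; simp [hR]; tauto
  have hU : ∀ v, v ∈ A ∨ v ∈ B ∨ v ∈ R := by
    intro x; simp only [hR, Finset.mem_sdiff, Finset.mem_univ, true_and, Finset.mem_union]; tauto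
  have hcard := card_split A B R d1 d2 d3 hU
  have hcap : (nb G.Adj v Finset.univ ∩ A).card ≤ r := by
    apply hB.card_le huv
    intro w; simp only [hA, Finset.mem_inter, mem_nb]; tauto
  have hBc : B.card + (nb G.Adj v Finset.univ ∩ A).card = (nb G.Adj v Finset.univ).card := by
    rw [hBd]; exact Finset.card_sdiff_add_card_inter _ _
  have hRc : R.card ≤ r + 2 := by omega
  refine ⟨A, B, R, d1, d2, d3, hU, hRc, ?_⟩
  have hsp := ee_split G A B R d1 d2 d3 hU
  have hAA : ee G.Adj A A ≤ A.card * r := by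
    apply ee_le_of_nb
    intro s hs
    apply hB.card_le (mem_nb.1 hs).2
    intro w hw
    have := mem_nb.1 hw
    exact ⟨(mem_nb.1 this.1).2, this.2⟩
  have hBB : ee G.Adj B B ≤ B.card * r := by
    apply ee_le_of_nb
    intro s hs
    have hs' := Finset.mem_sdiff.1 hs
    apply hB.card_le (mem_nb.1 hs'.1).2
    intro w hw
    have := mem_nb.1 hw
    exact ⟨(mem_nb.1 (Finset.mem_sdiff.1 this.1).1).2, this.2⟩
  have h1 := ee_le G.Adj R R
  have h2 := ee_le G.Adj R A
  have h3 := ee_le G.Adj R B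
  rw [← hn] at hcard
  have h4 : ee G.Adj R R + 2 * ee G.Adj R A + 2 * ee G.Adj R B ≤ 2 * ((r + 2) * n) := by
    have : R.card * R.card + 2 * (R.card * A.card) + 2 * (R.card * B.card) ≤ 2 * (R.card * n) := by
      rw [hcard]; nlinarith
    have := Nat.mul_le_mul_right n hRc
    omega
  have h5 : A.card * r + B.card * r ≤ n * r := by rw [hcard]; nlinarith
  nlinarith

end Stability

section Refine

theorem low_few {V : Type*} [DecidableEq V] (P : V → V → Prop) (n r : ℕ) (hn : 0 < n)
    (A B S : Finset V)
    (hS : ∀ s ∈ S, 100 * (nb P s B).card ≤ 28 * n) (hBc : 48 * n ≤ 100 * B.card)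
    (hm : 4 * (A.card * B.card) ≤ 4 * ee P A B + (8 * r + 12) * n) :
    (A ∩ S).card ≤ 15 * (r + 1) := by
  have h1 : ee P (A ∩ S) B ≤ (A ∩ S).card * (28 * n / 100) := by
    apply ee_le_of_nb
    intro s hs
    have := hS s (Finset.mem_inter.1 hs).2
    omega
  have h2 : ee P (A \ S) B ≤ (A \ S).card * B.card := ee_le _ _ _
  have h3 : ee P A B = ee P (A \ S) B + ee P (A ∩ S) B := by
    rw [← ee_union_left _ _ _ _ (Finset.disjoint_sdiff_inter A S), Finset.sdiff_union_inter]
  have h4 : (A \ S).card + (A ∩ S).card = A.card := Finset.card_sdiff_add_card_inter _ _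
  have h5 : 100 * (28 * n / 100) ≤ 28 * n := by omega
  generalize (A ∩ S).card = t at *
  generalize 28 * n / 100 = k at *
  rw [← h4, h3] at hm
  have h6 : 4 * (t * B.card) ≤ 4 * (t * k) + (8 * r + 12) * n := by nlinarith
  have h7 : t * (48 * n) ≤ t * (100 * B.card) := Nat.mul_le_mul_left _ hBc
  have h8 : t * (100 * k) ≤ t * (28 * n) := Nat.mul_le_mul_left _ h5
  have h9 : (20 * t) * n ≤ (200 * r + 300) * n := by nlinarith
  have := Nat.le_of_mul_le_mul_right h9 hn
  omega

theorem part_bound (n r a b E : ℕ) (hn : 1000000 * (r + 1) ≤ n) (hab : a + b ≤ n)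
    (hE : E ≤ a * b) (h : n * n ≤ 4 * E + (8 * r + 12) * n) : 100 * a ≤ 51 * n := by
  by_contra! hc
  have h1 : n * n ≤ 4 * (a * b) + (8 * r + 12) * n := by omega
  have h2 : 1000000 * ((8 * r + 12) * n) ≤ 12 * (n * n) := by nlinarith
  zify at *
  have h3 : (a : ℤ) * b ≤ a * (n - a) := by
    apply mul_le_mul_of_nonneg_left <;> linarith
  have h5 : ((2:ℤ) * a - n)^2 ≤ (8 * r + 12) * n := by nlinarith
  nlinarith

theorem refined_structure {V : Type*} [Fintype V] (G : SimpleGraph V) (n r : ℕ)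
    (hn : n = Fintype.card V) (hnr : 1000000 * (r + 1) ≤ n)
    (he : n * n ≤ 4 * G.edgeSet.ncard + 2 * n)
    (hB : BookFree r G) :
    ∃ A B S : Finset V, Disjoint A B ∧ Disjoint A S ∧ Disjoint B S ∧
      (∀ v, v ∈ A ∨ v ∈ B ∨ v ∈ S) ∧ S.card ≤ 32 * (r + 1) ∧
      (∀ a ∈ A, ∀ b ∈ A, ¬ G.Adj a b) ∧ (∀ a ∈ B, ∀ b ∈ B, ¬ G.Adj a b) ∧
      (∀ s ∈ S, 100 * (nb G.Adj s Finset.univ).card ≤ 28 * n) := by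
  classical
  obtain ⟨A, B, R, d1, d2, d3, hU, hR, hm⟩ := rough_structure G n r hn (by omega) he hB
  have hs : ∀ a b, G.Adj a b → G.Adj b a := fun a b h => h.symm
  have hc := card_split A B R d1 d2 d3 hU
  rw [← hn] at hc
  have hE := ee_le G.Adj A B
  have hA51 : 100 * A.card ≤ 51 * n := part_bound n r _ B.card _ hnr (by omega) hE hm
  have hB51 : 100 * B.card ≤ 51 * n :=
    part_bound n r _ A.card _ hnr (by omega) (by rw [mul_comm]; exact hE) hm
  have hA48 : 48 * n ≤ 100 * A.card := by omega
  have hB48 : 48 * n ≤ 100 * B.card := by omega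
  have hABn : 4 * (A.card * B.card) ≤ n * n := by
    have : A.card + B.card ≤ n := by omega
    have h2 := Nat.mul_le_mul this this
    zify at *
    nlinarith [sq_nonneg ((A.card : ℤ) - B.card)]
  have hm' : 4 * (A.card * B.card) ≤ 4 * ee G.Adj A B + (8 * r + 12) * n := hABn.trans hm
  -- degrees
  have hdeg : ∀ z, (nb G.Adj z Finset.univ).card ≤
      (nb G.Adj z A).card + (nb G.Adj z B).card + (r + 2) := by
    intro z
    have h1 := nb_add G.Adj z A B R d1 d2 d3 hU
    have h2 := nb_card_le G.Adj z R
    omega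
  have hdich : ∀ z, 100 * (nb G.Adj z A).card < 2 * n ∨ 100 * (nb G.Adj z B).card < 2 * n := by
    intro z
    by_contra! hcon
    obtain ⟨hx, hy⟩ := hcon
    set X := nb G.Adj z A with hX
    set Y := nb G.Adj z B with hY
    have k1 : ee G.Adj X Y ≤ X.card * r := by
      apply ee_le_of_nb
      intro s hs
      apply hB.card_le (mem_nb.1 hs).2
      intro w hw
      have := mem_nb.1 hw
      exact ⟨(mem_nb.1 this.1).2, this.2⟩
    have k2 := ee_add_not G.Adj X Y
    have k3 := ee_add_not G.Adj A B
    have k4 : ee (fun a b => ¬ G.Adj a b) X Y ≤ ee (fun a b => ¬ G.Adj a b) A B :=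
      ee_mono _ (fun w hw => (mem_nb.1 hw).1) (fun w hw => (mem_nb.1 hw).1)
    have k5 : 4 * (X.card * Y.card) ≤ 4 * (X.card * r) + (8 * r + 12) * n := by omega
    have k6 : X.card ≤ n := (nb_card_le _ _ _).trans (by omega)
    have k7 : X.card * r ≤ n * r := Nat.mul_le_mul_right _ k6
    have k8 : (2 * n) * (2 * n) ≤ (100 * X.card) * (100 * Y.card) := Nat.mul_le_mul hx hy
    have k9 : 1000000 * (r + 1) * n ≤ n * n := Nat.mul_le_mul_right _ hnr
    nlinarith
  set S : Finset V := Finset.univ.filter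
    (fun z => 100 * (nb G.Adj z Finset.univ).card ≤ 28 * n) with hSdef
  set A' : Finset V := Finset.univ.filter
    (fun z => ¬ 100 * (nb G.Adj z Finset.univ).card ≤ 28 * n ∧ 100 * (nb G.Adj z A).card < 2 * n)
  set B' : Finset V := Finset.univ.filter
    (fun z => ¬ 100 * (nb G.Adj z Finset.univ).card ≤ 28 * n ∧ ¬ 100 * (nb G.Adj z A).card < 2 * n)
  have hSlow : ∀ T, ∀ s ∈ S, 100 * (nb G.Adj s T).card ≤ 28 * n := by
    intro T s hs
    have h1 := (Finset.mem_filter.1 hs).2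
    have h2 := Finset.card_le_card (nb_mono G.Adj s (Finset.subset_univ T))
    omega
  refine ⟨A', B', S, ?_, ?_, ?_, ?_, ?_, ?_, ?_, ?_⟩
  · rw [Finset.disjoint_left]; intro x; simp only [A', B', Finset.mem_filter]; tauto
  · rw [Finset.disjoint_left]; intro x; simp only [A', S, Finset.mem_filter]; tauto
  · rw [Finset.disjoint_left]; intro x; simp only [S, B', Finset.mem_filter]; tauto
  · intro x; simp only [A', B', S, Finset.mem_filter, Finset.mem_univ, true_and]; tauto
  · have h1 := low_few G.Adj n r (by omega) A B S (hSlow B) hB48 hm'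
    have h2 := low_few G.Adj n r (by omega) B A S (hSlow A) hA48
      (by rw [ee_comm hs, mul_comm B.card]; exact hm')
    have h3 : S.card ≤ (A ∩ S).card + (B ∩ S).card + R.card := by
      have : S ⊆ (A ∩ S) ∪ (B ∩ S) ∪ R := by
        intro x hx
        have := hU x
        simp only [Finset.mem_union, Finset.mem_inter]
        tauto
      refine (Finset.card_le_card this).trans ((Finset.card_union_le _ _).trans ?_)
      have := Finset.card_union_le (A ∩ S) (B ∩ S)
      omega
    omega
  · intro a ha b hb hab
    have ha' := (Finset.mem_filter.1 ha).2
    have hb' := (Finset.mem_filter.1 hb).2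
    have h1 := hB.nb_le hab B
    have h2 := hdeg a
    have h3 := hdeg b
    omega
  · intro a ha b hb hab
    have ha' := (Finset.mem_filter.1 ha).2
    have hb' := (Finset.mem_filter.1 hb).2
    have h1 := hB.nb_le hab A
    have h2 := hdeg a
    have h3 := hdeg b
    have h4 := hdich a
    have h5 := hdich b
    omega
  · exact hSlow _

/-- low-degree vertices: at most two of them -/
theorem few_low {V : Type*} [Fintype V] (G : SimpleGraph V) (n r : ℕ)
    (hn : n = Fintype.card V) (hnr : 1000000 * (r + 1) ≤ n)
    (he : n * n ≤ 4 * G.edgeSet.ncard + 2 * n)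
    (A B S : Finset V) (d1 : Disjoint A B) (d2 : Disjoint A S) (d3 : Disjoint B S)
    (hU : ∀ v, v ∈ A ∨ v ∈ B ∨ v ∈ S) (hSc : S.card ≤ 32 * (r + 1))
    (hA : ∀ a ∈ A, ∀ b ∈ A, ¬ G.Adj a b) (hB : ∀ a ∈ B, ∀ b ∈ B, ¬ G.Adj a b)
    (hS : ∀ s ∈ S, 100 * (nb G.Adj s Finset.univ).card ≤ 28 * n) :
    S.card ≤ 2 := by
  classical
  have hsp := ee_split G A B S d1 d2 d3 hU
  rw [ee_eq_zero _ hA, ee_eq_zero _ hB] at hsp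
  have hE := ee_le G.Adj A B
  have hc := card_split A B S d1 d2 d3 hU
  rw [← hn] at hc
  have h1 : ee G.Adj S Finset.univ = ee G.Adj S A + ee G.Adj S B + ee G.Adj S S := by
    rw [ee_eq_sum_nb, ee_eq_sum_nb, ee_eq_sum_nb, ee_eq_sum_nb, ← Finset.sum_add_distrib,
      ← Finset.sum_add_distrib]
    exact Finset.sum_congr rfl fun s _ => nb_add G.Adj s A B S d1 d2 d3 hU
  have h2 : ee G.Adj S Finset.univ ≤ S.card * (28 * n / 100) := by
    apply ee_le_of_nb
    intro s hs
    have := hS s hs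
    omega
  have h3 : G.edgeSet.ncard ≤ A.card * B.card + S.card * (28 * n / 100) := by omega
  have h5 : 100 * (28 * n / 100) ≤ 28 * n := by omega
  generalize 28 * n / 100 = k at *
  generalize S.card = s at *
  generalize A.card = a at *
  generalize B.card = b at *
  generalize G.edgeSet.ncard = e at *
  clear h1 h2 hsp hE
  by_contra! hs3
  have h6 : 4 * (a * b) ≤ (a + b) * (a + b) := by
    zify; nlinarith [sq_nonneg ((a : ℤ) - b)]
  have h7 : s * (100 * k) ≤ s * (28 * n) := Nat.mul_le_mul_left _ h5
  have h8 : 10000 * s ≤ n := by omega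
  have h9 : s * (10000 * s) ≤ s * n := Nat.mul_le_mul_left _ h8
  have h10 : 3 * n ≤ s * n := Nat.mul_le_mul_right _ hs3
  have h11 : a + b = n - s := by omega
  rw [h11] at h6
  have hsn : s ≤ n := by omega
  zify [hsn] at *
  nlinarith

theorem not_both {V : Type*} [Fintype V] (G : SimpleGraph V) (n r : ℕ)
    (hnr : 1000000 * (r + 1) ≤ n) (hB : BookFree r G)
    (A B : Finset V) (hm : 100 * ee (fun a b => ¬ G.Adj a b) A B ≤ 7 * n)
    (z : V) (hz : 20 * n ≤ 100 * ((nb G.Adj z A).card + (nb G.Adj z B).card)) :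
    (∀ a ∈ A, ¬ G.Adj z a) ∨ (∀ b ∈ B, ¬ G.Adj z b) := by
  classical
  have hs : ∀ a b, G.Adj a b → G.Adj b a := fun a b h => h.symm
  by_contra! hc
  obtain ⟨⟨a, ha, hza⟩, b, hb, hzb⟩ := hc
  have h1 := hB.nb_le hza B
  have h2 := hB.nb_le hzb A
  have h3 : (nb G.Adj a B).card + (nb (fun a b => ¬ G.Adj a b) a B).card = B.card := by
    have := ee_add_not G.Adj {a} B
    rw [ee_singleton, ee_singleton] at this
    simpa using this
  have h4 : (nb G.Adj b A).card + (nb (fun a b => ¬ G.Adj a b) b A).card = A.card := by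
    have := ee_add_not G.Adj {b} A
    rw [ee_singleton, ee_singleton] at this
    simpa using this
  have h5 : (nb (fun a b => ¬ G.Adj a b) a B).card ≤ ee (fun a b => ¬ G.Adj a b) A B := by
    rw [← ee_singleton]
    exact ee_mono _ (by simpa using ha) subset_rfl
  have h6 : (nb (fun a b => ¬ G.Adj a b) b A).card ≤ ee (fun a b => ¬ G.Adj a b) A B := by
    rw [← ee_singleton, ee_comm (fun a b h h' => h (hs _ _ h')) A B]
    exact ee_mono _ (by simpa using hb) subset_rfl
  omega

theorem one_vertex {V : Type*} [Fintype V] (G : SimpleGraph V) (n r : ℕ)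
    (hn : n = Fintype.card V) (hnr : 1000000 * (r + 1) ≤ n)
    (he : n * n ≤ 4 * G.edgeSet.ncard + 2 * n)
    (hB : BookFree r G) :
    ∃ A B : Finset V, ∃ v, Disjoint A B ∧ v ∉ A ∧ v ∉ B ∧
      (∀ x, x ∈ A ∨ x ∈ B ∨ x = v) ∧
      (∀ a ∈ A, ∀ b ∈ A, ¬ G.Adj a b) ∧ (∀ a ∈ B, ∀ b ∈ B, ¬ G.Adj a b) := by
  classical
  have hs : ∀ a b, G.Adj a b → G.Adj b a := fun a b h => h.symm
  obtain ⟨A, B, S, d1, d2, d3, hU, hSc, iA, iB, hS⟩ := refined_structure G n r hn hnr he hB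
  have hS2 := few_low G n r hn hnr he A B S d1 d2 d3 hU hSc iA iB hS
  have hc := card_split A B S d1 d2 d3 hU
  rw [← hn] at hc
  rw [Finset.disjoint_left] at d1 d2 d3
  interval_cases hS3 : S.card
  · -- no low vertex: pick any vertex
    have hS0 : S = ∅ := Finset.card_eq_zero.1 hS3
    have : Nonempty V := Fintype.card_pos_iff.1 (by omega)
    obtain ⟨v⟩ := this
    refine ⟨A.erase v, B.erase v, v, ?_, by simp, by simp, ?_, ?_, ?_⟩
    · rw [Finset.disjoint_left]; intro x; simp only [Finset.mem_erase]
      intro h h'; exact d1 h.2 h'.2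
    · intro x
      have := hU x
      simp only [hS0, Finset.notMem_empty, or_false] at this
      simp only [Finset.mem_erase]; tauto
    · intro a ha b hb; exact iA a (Finset.mem_of_mem_erase ha) b (Finset.mem_of_mem_erase hb)
    · intro a ha b hb; exact iB a (Finset.mem_of_mem_erase ha) b (Finset.mem_of_mem_erase hb)
  · obtain ⟨v, rfl⟩ := Finset.card_eq_one.1 hS3
    refine ⟨A, B, v, Finset.disjoint_left.2 d1, ?_, ?_, by simpa using hU, iA, iB⟩
    · intro h; exact d2 h (by simp)
    · intro h; exact d3 h (by simp)
  · obtain ⟨v, w, hvw, rfl⟩ := Finset.card_eq_two.1 hS3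
    have hvA : v ∉ A := fun h => d2 h (by simp)
    have hvB : v ∉ B := fun h => d3 h (by simp)
    have hwA : w ∉ A := fun h => d2 h (by simp)
    have hwB : w ∉ B := fun h => d3 h (by simp)
    have key : (∀ a ∈ A, ¬ G.Adj w a) ∨ (∀ b ∈ B, ¬ G.Adj w b) := by
      have hsp := ee_split G A B {v, w} (Finset.disjoint_left.2 d1) (Finset.disjoint_left.2 d2)
        (Finset.disjoint_left.2 d3) hU
      rw [ee_eq_zero _ iA, ee_eq_zero _ iB] at hsp
      have hpair : ∀ T : Finset V, ee G.Adj {v, w} T = (nb G.Adj v T).card + (nb G.Adj w T).card := by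
        intro T; rw [ee_eq_sum_nb, Finset.sum_pair hvw]
      have hp1 := hpair A
      have hp2 := hpair B
      have hp3 := ee_le G.Adj {v, w} {v, w}
      rw [hS3] at hp3
      have hv := hS v (by simp)
      have hw := hS w (by simp)
      rw [nb_add G.Adj v A B {v, w} (Finset.disjoint_left.2 d1) (Finset.disjoint_left.2 d2)
        (Finset.disjoint_left.2 d3) hU] at hv
      rw [nb_add G.Adj w A B {v, w} (Finset.disjoint_left.2 d1) (Finset.disjoint_left.2 d2)
        (Finset.disjoint_left.2 d3) hU] at hw
      have hmis := ee_add_not G.Adj A B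
      have hAB : 4 * (A.card * B.card) ≤ (A.card + B.card) * (A.card + B.card) := by
        zify; nlinarith [sq_nonneg ((A.card : ℤ) - B.card)]
      have hab : A.card + B.card = n - 2 := by omega
      rw [hab] at hAB
      have hsq : (n - 2) * (n - 2) + 4 * n = n * n + 4 := by
        obtain ⟨m, rfl⟩ : ∃ m, n = m + 2 := ⟨n - 2, by omega⟩
        simp only [Nat.add_sub_cancel]; ring
      apply not_both G n r hnr hB A B
      · omega
      · omega
    rcases key with key | key
    · refine ⟨insert w A, B, v, ?_, ?_, hvB, ?_, ?_, iB⟩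
      · rw [Finset.disjoint_left]; intro x hx hx'
        rcases Finset.mem_insert.1 hx with rfl | h
        · exact hwB hx'
        · exact d1 h hx'
      · simp [hvw, hvA]
      · intro x; have := hU x
        simp only [Finset.mem_insert, Finset.mem_singleton] at this ⊢; tauto
      · intro a ha b hb hab
        rcases Finset.mem_insert.1 ha with rfl | ha2 <;> rcases Finset.mem_insert.1 hb with rfl | hb2
        · exact hab.ne rfl
        · exact key b hb2 hab
        · exact key a ha2 hab.symm
        · exact iA a ha2 b hb2 hab
    · refine ⟨A, insert w B, v, ?_, hvA, ?_, ?_, iA, ?_⟩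
      · rw [Finset.disjoint_right]; intro x hx hx'
        rcases Finset.mem_insert.1 hx with rfl | h
        · exact hwA hx'
        · exact d1 hx' h
      · simp [hvw, hvB]
      · intro x; have := hU x
        simp only [Finset.mem_insert, Finset.mem_singleton] at this ⊢; tauto
      · intro a ha b hb hab
        rcases Finset.mem_insert.1 ha with rfl | ha2 <;> rcases Finset.mem_insert.1 hb with rfl | hb2
        · exact hab.ne rfl
        · exact key b hb2 hab
        · exact key a ha2 hab.symm
        · exact iB a ha2 b hb2 hab

end Refine

section Final

open Classical in
theorem ee_eq_card {V : Type*} (P : V → V → Prop) (S T : Finset V) :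
    ee P S T = ((S ×ˢ T).filter (fun p => P p.1 p.2)).card := by
  rw [Finset.card_filter, Finset.sum_product]
  rfl

theorem card_le_ee {V : Type*} (P : V → V → Prop) (S T : Finset V) (Q : Finset (V × V))
    (hQ : ∀ p ∈ Q, (p.1 ∈ S ∧ p.2 ∈ T) ∧ P p.1 p.2) : Q.card ≤ ee P S T := by
  classical
  rw [ee_eq_card]
  apply Finset.card_le_card
  intro p hp
  rw [Finset.mem_filter, Finset.mem_product]
  exact hQ p hp

theorem final_arith (x y r m mXY E ab M eAB e : ℕ) (hr : 1 ≤ r) (hx : 1 ≤ x) (hy : 1 ≤ y)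
    (h1 : mXY ≤ m) (h2 : ab ≤ M) (h3 : eAB + m = ab) (h4 : M + 2 * r ≤ e) (h5 : e = eAB + x + y)
    (h6 : E + mXY = x * y) (h7 : E ≤ x * r) (h8 : E ≤ y * r) :
    ab = M ∧ e = M + 2 * r ∧ mXY = m ∧ 1 ≤ E ∧
      (m = 0 ∨ (r = 1 ∧ (y = 1 ∨ x = 1 ∨ (x = 2 ∧ y = 2 ∧ m = 2)))) := by
  have k1 : x * y + 2 * r ≤ x * r + x + y := by omega
  have k2 : x * y + 2 * r ≤ y * r + x + y := by omega
  rcases Nat.lt_or_ge 1 r with hr2 | hr2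
  · have hy2 : 2 ≤ y := by
      by_contra! h
      have : y = 1 := by omega
      subst this; omega
    have hx2 : 2 ≤ x := by
      by_contra! h
      have : x = 1 := by omega
      subst this; omega
    have hxr : x ≤ r := by
      by_contra! h
      obtain ⟨c, rfl⟩ : ∃ c, x = r + 1 + c := ⟨x - (r + 1), by omega⟩
      nlinarith [Nat.zero_le (c * (y - 1)), Nat.mul_le_mul_left c hy]
    have hyr : y ≤ r := by
      by_contra! h
      obtain ⟨c, rfl⟩ : ∃ c, y = r + 1 + c := ⟨y - (r + 1), by omega⟩
      nlinarith [Nat.mul_le_mul_left c hx]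
    have e1 : x = r := by omega
    have e2 : y = r := by omega
    have hm : m = 0 := by omega
    have : 1 ≤ x * y := Nat.mul_pos hx hy
    refine ⟨by omega, by omega, by omega, by omega, Or.inl hm⟩
  · have : r = 1 := by omega
    subst this
    by_cases c1 : y = 1
    · subst c1
      refine ⟨by omega, by omega, by omega, by omega, Or.inr ⟨rfl, Or.inl rfl⟩⟩
    by_cases c2 : x = 1
    · subst c2
      refine ⟨by omega, by omega, by omega, by omega, Or.inr ⟨rfl, Or.inr (Or.inl rfl)⟩⟩
    have hx2 : x = 2 := by
      by_contra hne
      obtain ⟨c, rfl⟩ : ∃ c, x = 3 + c := ⟨x - 3, by omega⟩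
      have hy2 : 2 ≤ y := by omega
      nlinarith [Nat.mul_le_mul_left c hy2]
    have hy2 : y = 2 := by
      subst hx2; omega
    subst hx2; subst hy2
    refine ⟨by omega, by omega, by omega, by omega, Or.inr ⟨rfl, Or.inr (Or.inr ⟨rfl, rfl, by omega⟩)⟩⟩

theorem colorable_of_parts {V : Type*} (G : SimpleGraph V) (A B : Finset V) (v : V)
    (hU : ∀ x, x ∈ A ∨ x ∈ B ∨ x = v)
    (iA : ∀ a ∈ A, ∀ b ∈ A, ¬ G.Adj a b) (iB : ∀ a ∈ B, ∀ b ∈ B, ¬ G.Adj a b)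
    (hv : ∀ a ∈ A, ¬ G.Adj v a) : G.Colorable 2 := by
  classical
  refine ⟨Coloring.mk (fun x => if x ∈ B then 0 else 1) ?_⟩
  intro x y hxy
  by_cases hx : x ∈ B <;> by_cases hy : y ∈ B
  · exact absurd hxy (iB x hx y hy)
  · simp [hx, hy]
  · simp [hx, hy]
  · exfalso
    have h1 := hU x
    have h2 := hU y
    simp only [hx, hy, false_or] at h1 h2
    rcases h1 with h1 | rfl <;> rcases h2 with h2 | rfl
    · exact iA x h1 y h2 hxy
    · exact hv x h1 hxy.symm
    · exact hv y h2 hxy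
    · exact hxy.ne rfl

theorem final_structure {V : Type*} [Fintype V] (G : SimpleGraph V) (r M : ℕ) (hr : 1 ≤ r)
    (hBF : BookFree r G) (hcol : ¬ G.Colorable 2) (A B : Finset V) (v : V)
    (hd : Disjoint A B) (hvA : v ∉ A) (hvB : v ∉ B)
    (hU : ∀ x, x ∈ A ∨ x ∈ B ∨ x = v)
    (iA : ∀ a ∈ A, ∀ b ∈ A, ¬ G.Adj a b) (iB : ∀ a ∈ B, ∀ b ∈ B, ¬ G.Adj a b)
    (hM : A.card * B.card ≤ M) (he : M + 2 * r ≤ G.edgeSet.ncard) :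
    A.card * B.card = M ∧ G.edgeSet.ncard = M + 2 * r ∧
      ∃ a ∈ A, ∃ b ∈ B, G.Adj v a ∧ G.Adj v b ∧ G.Adj a b ∧
        ∀ a' ∈ A, ∀ b' ∈ B, a' ≠ a → b' ≠ b → G.Adj a' b' := by
  classical
  have hs : ∀ a b, G.Adj a b → G.Adj b a := fun a b h => h.symm
  set X := nb G.Adj v A with hX
  set Y := nb G.Adj v B with hY
  have hx : 1 ≤ X.card := by
    by_contra! h
    have h0 : X = ∅ := Finset.card_eq_zero.1 (by omega)
    apply hcol
    apply colorable_of_parts G A B v hU iA iB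
    intro a ha hva
    have : a ∈ X := mem_nb.2 ⟨ha, hva⟩
    simp [h0] at this
  have hy : 1 ≤ Y.card := by
    by_contra! h
    have h0 : Y = ∅ := Finset.card_eq_zero.1 (by omega)
    apply hcol
    apply colorable_of_parts G B A v (fun x => by have := hU x; tauto) iB iA
    intro a ha hva
    have : a ∈ Y := mem_nb.2 ⟨ha, hva⟩
    simp [h0] at this
  have hsp := ee_split G A B {v} hd (by simpa using hvA) (by simpa using hvB) (by simpa using hU)
  rw [ee_eq_zero _ iA, ee_eq_zero _ iB, ee_eq_zero (S := {v}) (T := {v}) _ (by simp),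
    ee_singleton, ee_singleton, ← hX, ← hY] at hsp
  have hXA : X ⊆ A := fun w hw => (mem_nb.1 hw).1
  have hYB : Y ⊆ B := fun w hw => (mem_nb.1 hw).1
  have k1 : ee (fun a b => ¬ G.Adj a b) X Y ≤ ee (fun a b => ¬ G.Adj a b) A B :=
    ee_mono _ hXA hYB
  have k7 : ee G.Adj X Y ≤ X.card * r := by
    apply ee_le_of_nb
    intro s hs
    apply hBF.card_le (mem_nb.1 hs).2
    intro w hw
    have := mem_nb.1 hw
    exact ⟨(mem_nb.1 this.1).2, this.2⟩
  have k8 : ee G.Adj X Y ≤ Y.card * r := by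
    rw [ee_comm hs]
    apply ee_le_of_nb
    intro s hs
    apply hBF.card_le (mem_nb.1 hs).2
    intro w hw
    have := mem_nb.1 hw
    exact ⟨(mem_nb.1 this.1).2, this.2⟩
  obtain ⟨r1, r2, r3, r4, r5⟩ := final_arith X.card Y.card r _ _ _ _ M (ee G.Adj A B)
    G.edgeSet.ncard hr hx hy k1 hM (ee_add_not _ _ _) he (by omega) (ee_add_not _ _ _) k7 k8
  refine ⟨r1, r2, ?_⟩
  obtain ⟨a, ha, b, hb, hab⟩ := ee_pos G.Adj (S := X) (T := Y) (by omega)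
  have hva := (mem_nb.1 ha).2
  have hvb := (mem_nb.1 hb).2
  refine ⟨a, hXA ha, b, hYB hb, hva, hvb, hab, ?_⟩
  intro a' ha' b' hb' hna hnb
  by_contra hnadj
  have hin : a' ∈ X ∧ b' ∈ Y := by
    by_contra hnot
    have : ee (fun a b => ¬ G.Adj a b) X Y < ee (fun a b => ¬ G.Adj a b) A B := by
      rw [ee_eq_card, ee_eq_card]
      apply Finset.card_lt_card
      rw [Finset.ssubset_iff_of_subset]
      · refine ⟨(a', b'), ?_, ?_⟩
        · simp [ha', hb', hnadj]
        · simp only [Finset.mem_filter, Finset.mem_product]; tauto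
      · intro p
        simp only [Finset.mem_filter, Finset.mem_product]
        rintro ⟨⟨q1, q2⟩, q3⟩
        exact ⟨⟨hXA q1, hYB q2⟩, q3⟩
    omega
  rcases r5 with h0 | ⟨hr1, h1 | h1 | ⟨hx2, hy2, hm2⟩⟩
  · have := card_le_ee (fun a b => ¬ G.Adj a b) A B {(a', b')} (by simp [ha', hb', hnadj])
    rw [h0] at this
    simp at this
  · obtain ⟨c, hc⟩ := Finset.card_eq_one.1 h1
    have e1 := hin.2
    rw [hc, Finset.mem_singleton] at e1 hb
    exact hnb (e1.trans hb.symm)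
  · obtain ⟨c, hc⟩ := Finset.card_eq_one.1 h1
    have e1 := hin.1
    rw [hc, Finset.mem_singleton] at e1 ha
    exact hna (e1.trans ha.symm)
  · have n1 : ¬ G.Adj a b' := by
      intro h
      have := hBF.card_le hva {b, b'} (by
        intro w hw
        simp only [Finset.mem_insert, Finset.mem_singleton] at hw
        rcases hw with rfl | rfl
        · exact ⟨hvb, hab⟩
        · exact ⟨(mem_nb.1 hin.2).2, h⟩)
      rw [Finset.card_pair (Ne.symm hnb)] at this
      omega
    have n2 : ¬ G.Adj a' b := by
      intro h
      have := hBF.card_le hvb {a, a'} (by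
        intro w hw
        simp only [Finset.mem_insert, Finset.mem_singleton] at hw
        rcases hw with rfl | rfl
        · exact ⟨hva, hab.symm⟩
        · exact ⟨(mem_nb.1 hin.1).2, h.symm⟩)
      rw [Finset.card_pair (Ne.symm hna)] at this
      omega
    have hle := card_le_ee (fun a b => ¬ G.Adj a b) A B {(a', b'), (a, b'), (a', b)} (by
      intro p
      simp only [Finset.mem_insert, Finset.mem_singleton]
      rintro (rfl | rfl | rfl)
      · exact ⟨⟨ha', hb'⟩, hnadj⟩
      · exact ⟨⟨hXA ha, hb'⟩, n1⟩
      · exact ⟨⟨ha', hYB hb⟩, n2⟩)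
    rw [hm2, Finset.card_eq_three.2
      ⟨(a', b'), (a, b'), (a', b), by simp [hna], by simp [hnb], by simp [Ne.symm hna], rfl⟩] at hle
    omega

theorem cutCount_eq {V : Type*} (G : SimpleGraph V) (C D : Finset V) (h : Disjoint C D) :
    cutCount G (C : Set V) (D : Set V) = ee G.Adj C D := by
  classical
  rw [ee_eq_card, ← Set.ncard_coe_finset]
  unfold cutCount
  rw [Finset.disjoint_left] at h
  have hinj : Set.InjOn (fun p : V × V => s(p.1, p.2))
      (((C ×ˢ D).filter (fun p => G.Adj p.1 p.2) : Finset (V × V)) : Set (V × V)) := by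
    rintro ⟨a, b⟩ h1 ⟨c, d⟩ h2 heq
    simp only [Finset.coe_filter, Finset.mem_product, Set.mem_ofPred_eq] at h1 h2
    simp only [Sym2.eq_iff] at heq
    rcases heq with ⟨rfl, rfl⟩ | ⟨rfl, rfl⟩
    · rfl
    · exact absurd h2.1.2 (h h1.1.1)
  rw [← Set.InjOn.ncard_image hinj]
  congr 1
  ext e
  constructor
  · rintro ⟨he, u, hu, w, hw, rfl⟩
    refine ⟨(u, w), ?_, rfl⟩
    simp only [Finset.coe_filter, Finset.mem_product, Set.mem_ofPred_eq]
    exact ⟨⟨hu, hw⟩, he⟩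
  · rintro ⟨⟨u, w⟩, hp, rfl⟩
    simp only [Finset.coe_filter, Finset.mem_product, Set.mem_ofPred_eq] at hp
    exact ⟨hp.2, u, hp.1.1, w, hp.1.2, rfl⟩

theorem iso_of_parts {V : Type*} (G : SimpleGraph V) (A B : Finset V) (v a b : V)
    (hd : Disjoint A B) (hvA : v ∉ A) (hvB : v ∉ B) (ha : a ∈ A) (hb : b ∈ B)
    (hU : ∀ x, x ∈ A ∨ x ∈ B ∨ x = v)
    (iA : ∀ a ∈ A, ∀ b ∈ A, ¬ G.Adj a b) (iB : ∀ a ∈ B, ∀ b ∈ B, ¬ G.Adj a b)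
    (hfull : ∀ a' ∈ A, ∀ b' ∈ B, a' ≠ a → b' ≠ b → G.Adj a' b') (p q : ℕ)
    (hp : A.card = p + 1) (hq : B.card = q + 1) :
    Nonempty ((G.induce ({v, a, b}ᶜ : Set V)) ≃g completeBipartiteGraph (Fin p) (Fin q)) := by
  classical
  rw [Finset.disjoint_left] at hd
  have cA : (A.erase a).card = p := by rw [Finset.card_erase_of_mem ha]; omega
  have cB : (B.erase b).card = q := by rw [Finset.card_erase_of_mem hb]; omega
  let fA := (Finset.equivFinOfCardEq cA).symm
  let fB := (Finset.equivFinOfCardEq cB).symm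
  have mA : ∀ i, (fA i : V) ∈ A ∧ (fA i : V) ≠ a := fun i =>
    ⟨Finset.mem_of_mem_erase (fA i).2, Finset.ne_of_mem_erase (fA i).2⟩
  have mB : ∀ i, (fB i : V) ∈ B ∧ (fB i : V) ≠ b := fun i =>
    ⟨Finset.mem_of_mem_erase (fB i).2, Finset.ne_of_mem_erase (fB i).2⟩
  let g : Fin p ⊕ Fin q → ({v, a, b}ᶜ : Set V) := Sum.elim
    (fun i => ⟨fA i, by
      have := mA i
      simp only [Set.mem_compl_iff, Set.mem_insert_iff, Set.mem_singleton_iff, not_or]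
      exact ⟨fun h => hvA (h ▸ this.1), this.2, fun h => hd (h ▸ this.1) hb⟩⟩)
    (fun i => ⟨fB i, by
      have := mB i
      simp only [Set.mem_compl_iff, Set.mem_insert_iff, Set.mem_singleton_iff, not_or]
      exact ⟨fun h => hvB (h ▸ this.1), fun h => hd ha (h ▸ this.1), this.2⟩⟩)
  have gl : ∀ i, (g (Sum.inl i) : V) = fA i := fun i => rfl
  have gr : ∀ i, (g (Sum.inr i) : V) = fB i := fun i => rfl
  have hg : Function.Bijective g := by
    constructor
    · rintro (i | i) (j | j) hij <;> have hij' := congrArg Subtype.val hij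
      · rw [gl, gl] at hij'
        rw [fA.injective (Subtype.ext hij')]
      · rw [gl, gr] at hij'
        exact absurd (mB j).1 (hij' ▸ hd (mA i).1)
      · rw [gl, gr] at hij'
        exact absurd (mB i).1 (hij' ▸ hd (mA j).1)
      · rw [gr, gr] at hij'
        rw [fB.injective (Subtype.ext hij')]
    · rintro ⟨x, hx⟩
      simp only [Set.mem_compl_iff, Set.mem_insert_iff, Set.mem_singleton_iff, not_or] at hx
      rcases hU x with h | h | h
      · refine ⟨Sum.inl (fA.symm ⟨x, Finset.mem_erase.2 ⟨hx.2.1, h⟩⟩), ?_⟩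
        apply Subtype.ext
        rw [gl]; simp
      · refine ⟨Sum.inr (fB.symm ⟨x, Finset.mem_erase.2 ⟨hx.2.2, h⟩⟩), ?_⟩
        apply Subtype.ext
        rw [gr]; simp
      · exact absurd h hx.1
  refine ⟨(RelIso.symm ⟨Equiv.ofBijective g hg, ?_⟩)⟩
  intro x y
  simp only [Equiv.ofBijective_apply, SimpleGraph.comap_adj, Function.Embedding.subtype_apply]
  rcases x with i | i <;> rcases y with j | j
  · rw [gl, gl]; simp [iA _ (mA i).1 _ (mA j).1]
  · rw [gl, gr]; simp [hfull _ (mA i).1 _ (mB j).1 (mA i).2 (mB j).2]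
  · rw [gl, gr]; simp [(hfull _ (mA j).1 _ (mB i).1 (mA j).2 (mB i).2).symm]
  · rw [gr, gr]; simp [iB _ (mB i).1 _ (mB j).1]

theorem cut_of_parts {V : Type*} [Fintype V] (G : SimpleGraph V) (A B : Finset V) (v a b : V)
    (hd : Disjoint A B) (hvA : v ∉ A) (hvB : v ∉ B) (ha : a ∈ A) (hb : b ∈ B)
    (hU : ∀ x, x ∈ A ∨ x ∈ B ∨ x = v)
    (iA : ∀ a ∈ A, ∀ b ∈ A, ¬ G.Adj a b) (iB : ∀ a ∈ B, ∀ b ∈ B, ¬ G.Adj a b)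
    (hva : G.Adj v a) (hvb : G.Adj v b) (hab : G.Adj a b)
    (hfull : ∀ a' ∈ A, ∀ b' ∈ B, a' ≠ a → b' ≠ b → G.Adj a' b') :
    cutCount G {v, a, b} ({v, a, b}ᶜ) + 3 + (A.card - 1) * (B.card - 1) = G.edgeSet.ncard := by
  classical
  rw [Finset.disjoint_left] at hd
  set C : Finset V := {v, a, b} with hC
  have hCs : ({v, a, b} : Set V) = (C : Set V) := by simp [hC]
  have hnva : v ≠ a := hva.ne
  have hnvb : v ≠ b := hvb.ne
  have hnab : a ≠ b := hab.ne
  have hCm : ∀ x, x ∈ C ↔ x = v ∨ x = a ∨ x = b := by intro x; simp [hC]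
  set A' := A.erase a with hA'
  set B' := B.erase b with hB'
  have d1 : Disjoint A' B' := by
    rw [Finset.disjoint_left]; intro x hx hx'
    exact hd (Finset.mem_of_mem_erase hx) (Finset.mem_of_mem_erase hx')
  have d2 : Disjoint A' C := by
    rw [Finset.disjoint_left]; intro x hx hx'
    have h1 := Finset.mem_erase.1 hx
    rcases (hCm x).1 hx' with rfl | rfl | rfl
    · exact hvA h1.2
    · exact h1.1 rfl
    · exact hd h1.2 hb
  have d3 : Disjoint B' C := by
    rw [Finset.disjoint_left]; intro x hx hx'
    have h1 := Finset.mem_erase.1 hx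
    rcases (hCm x).1 hx' with rfl | rfl | rfl
    · exact hvB h1.2
    · exact hd ha h1.2
    · exact h1.1 rfl
  have hU' : ∀ x, x ∈ A' ∨ x ∈ B' ∨ x ∈ C := by
    intro x
    have := hU x
    rw [hCm, hA', hB', Finset.mem_erase, Finset.mem_erase]; tauto
  have hcompl : (C : Set V)ᶜ = ((A' ∪ B' : Finset V) : Set V) := by
    ext x
    have := hU' x
    rw [Finset.disjoint_left] at d2 d3
    have h2 := @d2 x
    have h3 := @d3 x
    simp only [Set.mem_compl_iff, Finset.mem_coe, Finset.mem_union]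
    tauto
  have hsp := ee_split G A' B' C d1 d2 d3 hU'
  have z1 : ee G.Adj A' A' = 0 := ee_eq_zero _ fun s hs t ht =>
    iA s (Finset.mem_of_mem_erase hs) t (Finset.mem_of_mem_erase ht)
  have z2 : ee G.Adj B' B' = 0 := ee_eq_zero _ fun s hs t ht =>
    iB s (Finset.mem_of_mem_erase hs) t (Finset.mem_of_mem_erase ht)
  have z3 : ee G.Adj A' B' = (A.card - 1) * (B.card - 1) := by
    rw [ee_full, Finset.card_erase_of_mem ha, Finset.card_erase_of_mem hb]
    intro s hs t ht
    exact hfull s (Finset.mem_of_mem_erase hs) t (Finset.mem_of_mem_erase ht)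
      (Finset.ne_of_mem_erase hs) (Finset.ne_of_mem_erase ht)
  have z4 : ee G.Adj C C = 6 := by
    unfold ee
    rw [hC]
    simp [Finset.sum_insert, hnva, hnvb, hnab, hva, hvb, hab, hva.symm, hvb.symm, hab.symm,
      -Finset.sum_boole]
  have z5 : cutCount G {v, a, b} ({v, a, b}ᶜ) = ee G.Adj C A' + ee G.Adj C B' := by
    rw [hCs, hcompl, cutCount_eq, ee_union_right _ _ _ _ d1]
    exact Finset.disjoint_union_right.2 ⟨d2.symm, d3.symm⟩
  omega

theorem prod_balanced (a b n : ℕ) (hn : 3 ≤ n) (h : a + b + 1 = n) :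
    a * b ≤ ((n - 1) / 2) * (n / 2) ∧
    (a * b = ((n - 1) / 2) * (n / 2) →
      (a = (n - 1) / 2 ∧ b = n / 2) ∨ (b = (n - 1) / 2 ∧ a = n / 2)) := by
  wlog hab : a ≤ b generalizing a b
  · have := this b a (by omega) (by omega)
    rw [mul_comm b a] at this
    tauto
  obtain ⟨c, hc⟩ : ∃ c, (n - 1) / 2 = a + c := ⟨(n-1)/2 - a, by omega⟩
  obtain ⟨d, hd⟩ : ∃ d, b = n / 2 + d := ⟨b - n/2, by omega⟩
  have hcd : c = d := by omega
  subst hcd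
  have hle : a + c ≤ n / 2 := by omega
  generalize n / 2 = m at *
  rw [hc, hd]
  constructor
  · nlinarith
  · intro h
    have : c = 0 := by
      by_contra hne
      have : 1 ≤ c := by omega
      nlinarith
    left; omega

end Final

/-- Let `r ≥ 1` and `n` sufficiently large.  If `G` is a non-bipartite `B_{r+1}`-free graph on
`n` vertices with the maximum number of edges among such graphs, then `G` contains a triangle
`C = w₁w₂w₃` such that the subgraph induced on the remaining `n - 3` vertices is isomorphic to
the Turán graph `T_{n-3,2}` (the complete bipartite graph with parts of sizes `⌊(n-3)/2⌋` and
`⌈(n-3)/2⌉`), and the number of edges between `V(C)` and the rest equals `n + 2r - 5`. -/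
theorem stmt_17 (r : ℕ) (hr : 1 ≤ r) :
    ∃ n₀ : ℕ, ∀ n : ℕ, n₀ ≤ n →
      ∀ G : SimpleGraph (Fin n), ¬ G.Colorable 2 → BookFree r G →
        (∀ H : SimpleGraph (Fin n), ¬ H.Colorable 2 → BookFree r H →
          H.edgeSet.ncard ≤ G.edgeSet.ncard) →
        ∃ w1 w2 w3 : Fin n, G.Adj w1 w2 ∧ G.Adj w2 w3 ∧ G.Adj w3 w1 ∧
          Nonempty ((G.induce ({w1, w2, w3}ᶜ : Set (Fin n))) ≃g
            completeBipartiteGraph (Fin ((n - 3) / 2)) (Fin ((n - 2) / 2))) ∧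
          cutCount G {w1, w2, w3} ({w1, w2, w3}ᶜ) = n + 2 * r - 5 := by
  refine ⟨1000000 * (r + 1), ?_⟩
  intro n hn G hcol hBF hmax
  obtain ⟨H, h1, h2, h3⟩ := lower_bound r n hr (by omega)
  have he : (n - 1) / 2 * (n / 2) + 2 * r ≤ G.edgeSet.ncard := h3.trans (hmax H h1 h2)
  have hee : n * n ≤ 4 * G.edgeSet.ncard + 2 * n := by
    have : n * n ≤ 4 * ((n - 1) / 2 * (n / 2)) + 2 * n := by
      rcases Nat.even_or_odd' n with ⟨k, hk | hk⟩
      · obtain ⟨j, rfl⟩ : ∃ j, k = j + 1 := ⟨k - 1, by omega⟩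
        have e1 : (n - 1) / 2 = j := by omega
        have e2 : n / 2 = j + 1 := by omega
        rw [e1, e2, hk]; nlinarith
      · have e1 : (n - 1) / 2 = k := by omega
        have e2 : n / 2 = k := by omega
        rw [e1, e2, hk]; nlinarith
    omega
  obtain ⟨A, B, v, hd, hvA, hvB, hU, iA, iB⟩ :=
    one_vertex G n r (by simp) hn hee hBF
  have hc : A.card + B.card + 1 = n := by
    have := card_split A B {v} hd (by simpa using hvA) (by simpa using hvB) (by simpa using hU)
    simp only [Fintype.card_fin, Finset.card_singleton] at this
    omega
  obtain ⟨hM, hbal⟩ := prod_balanced A.card B.card n (by omega) hc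
  have main : ∀ A B : Finset (Fin n), Disjoint A B → v ∉ A → v ∉ B →
      (∀ x, x ∈ A ∨ x ∈ B ∨ x = v) →
      (∀ a ∈ A, ∀ b ∈ A, ¬ G.Adj a b) → (∀ a ∈ B, ∀ b ∈ B, ¬ G.Adj a b) →
      A.card = (n - 1) / 2 → B.card = n / 2 →
      ∃ w1 w2 w3 : Fin n, G.Adj w1 w2 ∧ G.Adj w2 w3 ∧ G.Adj w3 w1 ∧
          Nonempty ((G.induce ({w1, w2, w3}ᶜ : Set (Fin n))) ≃g
            completeBipartiteGraph (Fin ((n - 3) / 2)) (Fin ((n - 2) / 2))) ∧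
          cutCount G {w1, w2, w3} ({w1, w2, w3}ᶜ) = n + 2 * r - 5 := by
    intro A B hd hvA hvB hU iA iB cA cB
    obtain ⟨_, r2, a, ha, b, hb, hva, hvb, hab, hfull⟩ :=
      final_structure G r _ hr hBF hcol A B v hd hvA hvB hU iA iB (by rw [cA, cB]) he
    refine ⟨v, a, b, hva, hab, hvb.symm, ?_, ?_⟩
    · exact iso_of_parts G A B v a b hd hvA hvB ha hb hU iA iB hfull _ _ (by omega) (by omega)
    · have := cut_of_parts G A B v a b hd hvA hvB ha hb hU iA iB hva hvb hab hfull
      rw [r2, cA, cB] at this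
      obtain ⟨p, hp⟩ : ∃ p, (n - 1) / 2 = p + 1 := ⟨(n - 1) / 2 - 1, by omega⟩
      obtain ⟨q, hq⟩ : ∃ q, n / 2 = q + 1 := ⟨n / 2 - 1, by omega⟩
      have hpq : p + q + 3 = n := by omega
      rw [hp, hq] at this
      simp only [Nat.add_sub_cancel] at this
      have h5 : (p + 1) * (q + 1) = p * q + p + q + 1 := by ring
      omega
  have hfs := final_structure G r _ hr hBF hcol A B v hd hvA hvB hU iA iB hM he
  rcases hbal hfs.1 with ⟨h1, h2⟩ | ⟨h1, h2⟩
  · exact main A B hd hvA hvB hU iA iB h1 h2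
  · exact main B A hd.symm hvB hvA (fun x => by have := hU x; tauto) iB iA h1 h2
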